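/- Let M be a finite-above E-unitary inverse monoid, let a, b ∈ M with a σ b, and let v ∈ M. Let D = {d ∈ M : d σ v and d is maximal in M}. Then: (i) D is nonempty; (ii) every element of the set H(a,b;v) = {d⁻¹·a·b⁻¹·d : d ∈ D} is idempotent; and (iii) H(a,b;v) has a least upper bound in M with respect to the natural partial order. -/

import Mathlib

namespace FInv

variable {M : Type*}

/-- The natural partial order on an inverse monoid: `a ≤ b` iff `a = e * b`
for some idempotent `e`. -/
def natLe [Monoid M] (a b : M) : Prop := ∃ e : M, e * e = e ∧ a = e * b

/-- `inv` is an inversion map making the monoid an inverse monoid: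
every element has a unique generalized inverse, given by `inv`. -/
def IsInverseMonoid [Monoid M] (inv : M → M) : Prop :=
  (∀ a : M, a * inv a * a = a) ∧ (∀ a : M, inv a * a * inv a = inv a) ∧
    (∀ a b : M, a * b * a = a → b * a * b = b → b = inv a)

/-- `m` is maximal with respect to the natural partial order. -/
def IsMaximal [Monoid M] (m : M) : Prop := ∀ n : M, natLe m n → n = m

/-- `M` is finite-above: the set of elements above any element is finite. -/
def FiniteAbove (M : Type*) [Monoid M] : Prop := ∀ m : M, {n : M | natLe m n}.Finite

/-- The least group congruence `σ`: `a σ b` iff some element lies below both. -/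
def sigmaRel [Monoid M] (a b : M) : Prop := ∃ c : M, natLe c a ∧ natLe c b

/-- `M` is E-unitary: every element above an idempotent is idempotent. -/
def EUnitary (M : Type*) [Monoid M] : Prop :=
  ∀ e a : M, e * e = e → natLe e a → a * a = a

/-- The set of idempotents of `M`. -/
def idems (M : Type*) [Monoid M] : Set M := {e : M | e * e = e}

/-- The submonoid generated by `S` together with the inverses of elements of `S`,
i.e. the closure of `S` under multiplication and inversion. -/
def invClosure [Monoid M] (inv : M → M) (S : Set M) : Submonoid M :=
  Submonoid.closure (S ∪ inv '' S)

/-- `M` is quasi-generated by `S`: `M` is generated, under multiplication and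
inversion, by `S` together with the idempotents of `M`. -/
def QuasiGen [Monoid M] (inv : M → M) (S : Set M) : Prop :=
  invClosure inv (S ∪ idems M) = ⊤

/-- A homomorphism is idempotent-separating if it is injective on idempotents. -/
def IdempotentSeparating [Monoid M] {N : Type*} [Monoid N] (φ : M →* N) : Prop :=
  ∀ e f : M, e * e = e → f * f = f → φ e = φ f → e = f

/-- A dual premorphism from a group `H` to an inverse monoid `M` (with inversion `inv`). -/
def IsDualPremorphism {H : Type*} [Group H] [Monoid M] (inv : M → M) (ψ : H → M) : Prop :=
  ψ 1 = 1 ∧ (∀ h : H, ψ h⁻¹ = inv (ψ h)) ∧ ∀ g h : H, natLe (ψ g * ψ h) (ψ (g * h))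

/-- Property (1): every element of `M` lies below some `ψ h`. -/
def Property1 {H : Type*} [Group H] [Monoid M] (ψ : H → M) : Prop :=
  ∀ m : M, ∃ h : H, natLe m (ψ h)

end FInv

open FInv

theorem idem_mul_idem {M : Type*} [Monoid M] {inv : M → M} (hM : IsInverseMonoid inv)
    {e f : M} (he : e * e = e) (hf : f * f = f) : (e * f) * (e * f) = e * f := by
  obtain ⟨h1, h2, h3⟩ := hM
  have he' : ∀ z, e * (e * z) = e * z := fun z => by rw [← mul_assoc, he]
  have hf' : ∀ z, f * (f * z) = f * z := fun z => by rw [← mul_assoc, hf]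
  have k1 := h1 (e * f)
  have k2 := h2 (e * f)
  generalize hx : inv (e * f) = x at k1 k2
  have k2' : ∀ z, x * (e * (f * (x * z))) = x * z := fun z => by
    conv_rhs => rw [← k2]
    simp only [mul_assoc]
  have hfx : f * x * e = x := by
    rw [← hx]
    refine h3 (e * f) _ ?_ ?_
    · rw [hx]
      simp only [mul_assoc, he', hf'] at k1 ⊢
      exact k1
    · rw [hx]
      simp only [mul_assoc, he', hf', k2']
  have hxx : x * x = x := by
    calc x * x = (f * x * e) * (f * x * e) := by rw [hfx]
      _ = f * x * e := by simp only [mul_assoc, k2']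
      _ = x := hfx
  have i1 : x = inv x := h3 x x (by rw [hxx, hxx]) (by rw [hxx, hxx])
  have i2 : e * f = inv x := h3 x (e * f) k2 k1
  rw [i2, ← i1, hxx]

theorem idem_comm {M : Type*} [Monoid M] {inv : M → M} (hM : IsInverseMonoid inv)
    {e f : M} (he : e * e = e) (hf : f * f = f) : e * f = f * e := by
  have k1 := idem_mul_idem hM he hf
  have k2 := idem_mul_idem hM hf he
  obtain ⟨h1, h2, h3⟩ := hM
  have he' : ∀ z, e * (e * z) = e * z := fun z => by rw [← mul_assoc, he]
  have hf' : ∀ z, f * (f * z) = f * z := fun z => by rw [← mul_assoc, hf]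
  have i1 : e * f = inv (e * f) := h3 _ _ (by rw [k1, k1]) (by rw [k1, k1])
  have i2 : f * e = inv (e * f) := by
    refine h3 _ _ ?_ ?_
    · simp only [mul_assoc, he', hf'] at k1 ⊢
      exact k1
    · simp only [mul_assoc, he', hf'] at k2 ⊢
      exact k2
  rw [i1, ← i2]

theorem natLe_rfl {M : Type*} [Monoid M] (a : M) : natLe a a := ⟨1, by simp, by simp⟩

theorem natLe_tr {M : Type*} [Monoid M] {inv : M → M} (hM : IsInverseMonoid inv)
    {a b c : M} (hab : natLe a b) (hbc : natLe b c) : natLe a c := by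
  obtain ⟨e, he, rfl⟩ := hab
  obtain ⟨f, hf, rfl⟩ := hbc
  exact ⟨e * f, idem_mul_idem hM he hf, by rw [mul_assoc]⟩

theorem natLe_anti {M : Type*} [Monoid M] {inv : M → M} (hM : IsInverseMonoid inv)
    {a b : M} (hab : natLe a b) (hba : natLe b a) : a = b := by
  obtain ⟨e, he, h1⟩ := hab
  obtain ⟨f, hf, h2⟩ := hba
  have h3 : e * a = a := by rw [h1, ← mul_assoc, he]
  calc a = e * (f * a) := by rw [← h2, ← h1]
    _ = f * (e * a) := by rw [← mul_assoc, idem_comm hM he hf, mul_assoc]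
    _ = b := by rw [h3, ← h2]

theorem idem_conj {M : Type*} [Monoid M] {inv : M → M} (hM : IsInverseMonoid inv)
    {x y f : M} (hxy : x * y * x = x) (hf : f * f = f) :
    (x * f * y) * (x * f * y) = x * f * y := by
  have hyx : (y * x) * (y * x) = y * x := by
    rw [mul_assoc, ← mul_assoc x, hxy]
  calc (x * f * y) * (x * f * y) = x * (f * (y * x)) * f * y := by simp only [mul_assoc]
    _ = (x * y * x) * (f * f) * y := by rw [idem_comm hM hf hyx]; simp only [mul_assoc]
    _ = x * f * y := by rw [hxy, hf]

theorem exists_max {M : Type*} [Monoid M] {inv : M → M} (hM : IsInverseMonoid inv)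
    (hfa : FiniteAbove M) (v : M) : ∃ d, natLe v d ∧ IsMaximal d := by
  induction hn : {n : M | natLe v n}.ncard using Nat.strong_induction_on generalizing v with
  | _ k ih =>
    by_cases hv : IsMaximal v
    · exact ⟨v, natLe_rfl v, hv⟩
    · unfold IsMaximal at hv
      push Not at hv
      obtain ⟨n, hvn, hne⟩ := hv
      have hlt : {m : M | natLe n m}.ncard < k := by
        rw [← hn]
        refine Set.ncard_lt_ncard ⟨fun m hm => natLe_tr hM hvn hm, fun hs => ?_⟩ (hfa v)
        exact hne (natLe_anti hM (hs (natLe_rfl v)) hvn)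
      obtain ⟨d, hd, hmax⟩ := ih _ hlt n rfl
      exact ⟨d, natLe_tr hM hvn hd, hmax⟩

theorem idem_mul_inv {M : Type*} [Monoid M] {inv : M → M} (hM : IsInverseMonoid inv)
    (hEU : EUnitary M) {a b : M} (hab : sigmaRel a b) :
    (a * inv b) * (a * inv b) = a * inv b := by
  obtain ⟨c, ⟨e, he, hce⟩, f, hf, hcf⟩ := hab
  have h1 := hM.1
  have h2 := hM.2.1
  have h3 := hM.2.2
  have hbb : (b * inv b) * (b * inv b) = b * inv b := by rw [← mul_assoc, h1]
  have hcomm := idem_comm hM hf hbb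
  have hci : inv b * f = inv c := by
    refine h3 c _ ?_ ?_
    · rw [hcf]
      calc f * b * (inv b * f) * (f * b) = f * ((b * inv b) * (f * f)) * b := by
            simp only [mul_assoc]
        _ = (f * f) * (b * inv b * b) := by rw [hf, ← hcomm, ← mul_assoc f f, hf]; simp only [mul_assoc]
        _ = f * b := by rw [hf, h1]
    · rw [hcf]
      calc inv b * f * (f * b) * (inv b * f) = inv b * ((f * f) * (b * inv b)) * f := by
            simp only [mul_assoc]
        _ = (inv b * b * inv b) * (f * f) := by rw [hf, hcomm]; simp only [mul_assoc, hf]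
        _ = inv b * f := by rw [hf, h2]
  have hcc : (c * inv c) * (c * inv c) = c * inv c := by rw [← mul_assoc, h1]
  refine hEU (c * inv c) _ hcc ?_
  have hx := h1 (a * inv b)
  have hx2 := h2 (a * inv b)
  generalize hxd : a * inv b = x at hx hx2 ⊢
  have hyx : (inv x * x) * (inv x * x) = inv x * x := by rw [← mul_assoc, hx2]
  refine ⟨e * (x * f * inv x), idem_mul_idem hM he (idem_conj hM hx hf), ?_⟩
  calc c * inv c = e * ((a * inv b) * f) := by rw [← hci, hce]; simp only [mul_assoc]
    _ = e * ((x * inv x * x) * f) := by rw [hxd, hx]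
    _ = e * (x * ((inv x * x) * f)) := by simp only [mul_assoc]
    _ = e * (x * f * inv x) * x := by rw [idem_comm hM hyx hf]; simp only [mul_assoc]

/-- For σ-related `a, b` and any `v` in a finite-above E-unitary inverse monoid:
the set `D` of maximal elements σ-related to `v` is nonempty, each
`d⁻¹ * a * b⁻¹ * d` (`d ∈ D`) is idempotent, and the set of all these elements
has a least upper bound with respect to the natural partial order. -/
theorem stmt11 {M : Type*} [Monoid M] (inv : M → M)
    (hM : IsInverseMonoid inv) (hfa : FiniteAbove M) (hEU : EUnitary M)
    (a b : M) (hab : sigmaRel a b) (v : M) :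
    {d : M | sigmaRel d v ∧ IsMaximal d}.Nonempty ∧
    (∀ d : M, sigmaRel d v → IsMaximal d →
      (inv d * a * inv b * d) * (inv d * a * inv b * d) = inv d * a * inv b * d) ∧
    ∃ h : M,
      (∀ d : M, sigmaRel d v → IsMaximal d → natLe (inv d * a * inv b * d) h) ∧
      ∀ h' : M,
        (∀ d : M, sigmaRel d v → IsMaximal d → natLe (inv d * a * inv b * d) h') →
        natLe h h' := by
  have hidem : ∀ d : M, (inv d * a * inv b * d) * (inv d * a * inv b * d)
      = inv d * a * inv b * d := by
    intro d
    have := idem_conj hM (hM.2.1 d) (idem_mul_inv hM hEU hab)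
    simpa only [mul_assoc] using this
  obtain ⟨d₀, hd₀, hmax₀⟩ := exists_max hM hfa v
  have hσ₀ : sigmaRel d₀ v := ⟨v, hd₀, natLe_rfl v⟩
  refine ⟨⟨d₀, hσ₀, hmax₀⟩, fun d _ _ => hidem d, ?_⟩
  let U : Set M := {h | ∀ d : M, sigmaRel d v → IsMaximal d → natLe (inv d * a * inv b * d) h}
  have hUfin : U.Finite := (hfa (inv d₀ * a * inv b * d₀)).subset
    fun h hh => hh d₀ hσ₀ hmax₀
  have hUid : ∀ h ∈ U, h * h = h := fun h hh => hEU _ h (hidem d₀) (hh d₀ hσ₀ hmax₀)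
  have hU1 : (1 : M) ∈ U := fun d _ _ => ⟨_, hidem d, by rw [mul_one]⟩
  have hUmul : ∀ g ∈ U, ∀ h ∈ U, g * h ∈ U := by
    intro g hg h hh d hd hm
    obtain ⟨e, he, h1⟩ := hg d hd hm
    obtain ⟨f, hf, h2⟩ := hh d hd hm
    have hi := hidem d
    generalize inv d * a * inv b * d = p at *
    refine ⟨p, hi, ?_⟩
    have pg : p * g = p := by rw [h1, mul_assoc, hUid g hg]
    have ph : p * h = p := by rw [h2, mul_assoc, hUid h hh]
    rw [← mul_assoc, pg, ph]
  have key : ∀ S : Set M, S.Finite → S ⊆ U → ∃ h ∈ U, ∀ s ∈ S, natLe h s := by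
    intro S hS
    induction S, hS using Set.Finite.induction_on with
    | empty => exact fun _ => ⟨1, hU1, by simp⟩
    | @insert s S _ _ ih =>
      intro hsub
      obtain ⟨h, hh, hle⟩ := ih fun x hx => hsub (Set.mem_insert_of_mem _ hx)
      have hs : s ∈ U := hsub (Set.mem_insert _ _)
      refine ⟨h * s, hUmul h hh s hs, ?_⟩
      intro t ht
      rcases ht with rfl | ht
      · exact ⟨h, hUid h hh, rfl⟩
      · exact natLe_tr hM ⟨s, hUid s hs, idem_comm hM (hUid h hh) (hUid s hs)⟩ (hle t ht)
  obtain ⟨h, hh, hle⟩ := key U hUfin subset_rfl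
  exact ⟨h, hh, hle⟩
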